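/- Truthfulness under partial enforcement (Model 2): in the setting of the maximal-equilibrium mechanism, define for each agent i the outside-option value v_i(t) = sup_{z ≥ 0} (b_i(t + z) − c_i·z). Fix agent i with true type (b_i, c_i), let (b̂_i, ĉ_i) be any misreport satisfying the same regularity conditions (continuous, nondecreasing, concave benefit with vanishing marginal value; positive cost), let X be a pure Nash equilibrium of the true game whose total-data vector componentwise dominates that of every pure Nash equilibrium of the true game, and let X' be a pure Nash equilibrium of the misreported game whose total-data vector componentwise dominates that of every pure Nash equilibrium of the misreported game. Then v_i(t_i(X')) − c_i · X' i ≤ v_i(t_i(X)) − c_i · X i. -/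

import Mathlib

open Finset

/-- Agent `i`'s total accessible data under fair exchange. -/
noncomputable def total {n : ℕ} (X : Fin n → ℝ) (i : Fin n) : ℝ :=
  X i + ∑ j ∈ univ.filter (fun j => j ≠ i), min (X i) (X j)

/-- Agent `i`'s utility in the game with benefit functions `b` and costs `c`. -/
noncomputable def U {n : ℕ} (b : Fin n → ℝ → ℝ) (c : Fin n → ℝ)
    (X : Fin n → ℝ) (i : Fin n) : ℝ :=
  b i (total X i) - c i * X i

/-- `X` is a (nonnegative) pure Nash equilibrium of the game with benefits `b`, costs `c`. -/
def IsNE {n : ℕ} (b : Fin n → ℝ → ℝ) (c : Fin n → ℝ) (X : Fin n → ℝ) : Prop :=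
  (∀ i, 0 ≤ X i) ∧
    ∀ i, ∀ y, 0 ≤ y → U b c (Function.update X i y) i ≤ U b c X i

/-- The outside-option value: `v t = sup_{z ≥ 0} (b (t + z) - c * z)`. -/
noncomputable def outsideOption (b : ℝ → ℝ) (c : ℝ) (t : ℝ) : ℝ :=
  sSup ((fun z => b (t + z) - c * z) '' Set.Ici 0)

noncomputable def FF {n : ℕ} (X : Fin n → ℝ) (y : ℝ) : ℝ := ∑ j, min y (X j)

def Greedy {n : ℕ} (b : Fin n → ℝ → ℝ) (c : Fin n → ℝ) (G : Fin n → ℝ)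
    (A : Finset (Fin n)) : Prop :=
  ∀ S : Finset (Fin n), S ⊆ A → S.Nonempty → ∃ k ∈ S, (∀ j ∈ S, G k ≤ G j) ∧
    ∀ r, 0 < r → b k (FF G (G k) + (S.card : ℝ) * r) - c k * r < b k (FF G (G k))

def NoDown {n : ℕ} (b : ℝ → ℝ) (c : ℝ) (X : Fin n → ℝ) (k : Fin n) (x : ℝ) : Prop :=
  ∀ y, x ≤ y → y ≤ X k → b (FF X y) - c * y ≤ b (FF X (X k)) - c * X k

lemma total_eq_FF {n : ℕ} (X : Fin n → ℝ) (i : Fin n) : total X i = FF X (X i) := by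
  unfold total FF
  rw [← Finset.add_sum_erase univ _ (Finset.mem_univ i), min_self]
  congr 2
  ext j; simp

lemma total_upd {n : ℕ} (X : Fin n → ℝ) (i : Fin n) (y : ℝ) :
    total (Function.update X i y) i = FF X y - min y (X i) + y := by
  have h1 : total (Function.update X i y) i
      = y + ∑ j ∈ univ.erase i, min y (X j) := by
    unfold total
    rw [Function.update_self]
    congr 1
    apply Finset.sum_congr
    · ext j; simp
    · intro j hj
      rw [Function.update_of_ne (Finset.ne_of_mem_erase hj)]
  rw [h1]
  unfold FF
  rw [← Finset.add_sum_erase univ _ (Finset.mem_univ i)]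
  ring

lemma FF_nonneg {n : ℕ} {X : Fin n → ℝ} (h : ∀ j, 0 ≤ X j) {y : ℝ} (hy : 0 ≤ y) : 0 ≤ FF X y :=
  Finset.sum_nonneg fun j _ => le_min hy (h j)

lemma FF_mono {n : ℕ} (X : Fin n → ℝ) {x y : ℝ} (h : x ≤ y) : FF X x ≤ FF X y :=
  Finset.sum_le_sum fun j _ => min_le_min_right _ h

lemma FF_slope {n : ℕ} (P : Fin n → ℝ) {x y : ℝ} (h : x ≤ y) :
    FF P y ≤ FF P x + ((univ.filter (fun j => x < P j)).card : ℝ) * (y - x) := by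
  unfold FF
  rw [← nsmul_eq_mul, ← Finset.sum_const, Finset.sum_filter, ← Finset.sum_add_distrib]
  apply Finset.sum_le_sum
  intro j _
  split_ifs with hj
  · rw [min_eq_left hj.le]
    linarith [min_le_left y (P j)]
  · rw [min_eq_right (not_lt.1 hj)]
    linarith [min_le_right y (P j)]

lemma FF_upd_slope {n : ℕ} (P : Fin n → ℝ) (k : Fin n) {y : ℝ} (h : P k ≤ y) :
    FF P y - min y (P k) + y ≤ FF P (P k) +
      ((insert k (univ.filter (fun j => P k < P j))).card : ℝ) * (y - P k) := by
  have := FF_slope P h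
  rw [Finset.card_insert_of_notMem (by simp), min_eq_right h]
  push_cast
  linarith

/-- Staying below one's own level. -/
lemma IsNE.noDown {n : ℕ} {b : Fin n → ℝ → ℝ} {c : Fin n → ℝ} {X : Fin n → ℝ}
    (h : IsNE b c X) (k : Fin n) : NoDown (b k) (c k) X k 0 := by
  intro y hy hyk
  have := h.2 k y hy
  unfold U at this
  rw [total_upd, total_eq_FF, Function.update_self, min_eq_left hyk] at this
  simpa using this

lemma isNE_of_greedy {n : ℕ} {b : Fin n → ℝ → ℝ} {c : Fin n → ℝ} {G : Fin n → ℝ}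
    (hbm : ∀ j, MonotoneOn (b j) (Set.Ici 0))
    (h0 : ∀ j, 0 ≤ G j) (hg : Greedy b c G univ) (hd : ∀ k, NoDown (b k) (c k) G k 0) :
    IsNE b c G := by
  refine ⟨h0, fun k y hy => ?_⟩
  unfold U
  rw [total_upd, total_eq_FF, Function.update_self]
  rcases le_or_gt y (G k) with h | h
  · rw [min_eq_left h]
    simpa using hd k y hy h
  · obtain ⟨k', hk', hmin, hr⟩ := hg (insert k (univ.filter (fun j => G k < G j)))
      (Finset.subset_univ _) ⟨k, by simp⟩
    have hkk : k' = k := by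
      rcases Finset.mem_insert.1 hk' with h1 | h1
      · exact h1
      · have := hmin k (by simp)
        have h2 := (Finset.mem_filter.1 h1).2
        linarith
    subst hkk
    have h1 := hr (y - G k') (by linarith)
    have h2 := FF_upd_slope G k' h.le
    have h3 : 0 ≤ FF G y - min y (G k') + y := by
      have := FF_nonneg h0 hy
      linarith [min_le_left y (G k')]
    have h4 := hbm k' (Set.mem_Ici.2 h3) (Set.mem_Ici.2 (h3.trans h2)) h2
    linarith

lemma greedy_key {n : ℕ} {b : Fin n → ℝ → ℝ} {c : Fin n → ℝ} {G P : Fin n → ℝ}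
    (hg : Greedy b c G univ) (k : Fin n) (hk : G k < P k)
    (hagree : ∀ j, min (G k) (P j) = min (G k) (G j)) :
    ∃ k', G k' = G k ∧ G k < P k' ∧ ∀ r, 0 < r →
      b k' (FF G (G k) + ((univ.filter (fun j => G k < P j)).card : ℝ) * r) - c k' * r
        < b k' (FF G (G k)) := by
  obtain ⟨k', hk', hmin, hr⟩ := hg (univ.filter (fun j => G k < P j))
      (Finset.subset_univ _) ⟨k, by simpa using hk⟩
  have h1 : G k < P k' := by simpa using hk'
  have h2 : G k' = G k := by
    apply le_antisymm
    · exact hmin k (by simpa using hk)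
    · have := hagree k'
      rw [min_eq_left h1.le] at this
      rw [this]; exact min_le_right _ _
  rw [h2] at hr
  exact ⟨k', h2, h1, hr⟩

lemma FF_congr {n : ℕ} {G P : Fin n → ℝ} {x : ℝ}
    (hagree : ∀ j, min x (P j) = min x (G j)) : FF P x = FF G x :=
  Finset.sum_congr rfl fun j _ => hagree j

lemma key_contra {n : ℕ} {b : ℝ → ℝ} {c : ℝ} {G P : Fin n → ℝ} {x : ℝ} {k : Fin n}
    (hbm : MonotoneOn b (Set.Ici 0)) (hx : 0 ≤ x) (hP0 : ∀ j, 0 ≤ P j)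
    (hagree : ∀ j, min x (P j) = min x (G j)) (hk : x < P k)
    (hd : NoDown b c P k 0)
    (hr : ∀ r, 0 < r →
      b (FF G x + ((univ.filter (fun j => x < P j)).card : ℝ) * r) - c * r < b (FF G x)) :
    False := by
  have h1 := hr (P k - x) (by linarith)
  have h2 := hd x hx hk.le
  have h3 := FF_slope P hk.le
  have h0 := FF_nonneg hP0 (hP0 k)
  have h4 := hbm (Set.mem_Ici.2 h0) (Set.mem_Ici.2 (h0.trans h3)) h3
  rw [FF_congr hagree] at h4 h2
  linarith

/-- Two profiles that differ below level `m` have a first place where they differ. -/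
lemma first_diff {n : ℕ} {G P : Fin n → ℝ} (k0 : Fin n) (h : G k0 ≠ P k0) :
    ∃ k, G k ≠ P k ∧ min (G k) (P k) ≤ min (G k0) (P k0) ∧
      ∀ j, min (min (G k) (P k)) (P j) = min (min (G k) (P k)) (G j) := by
  obtain ⟨k, hk, hmin⟩ := Finset.exists_min_image (univ.filter (fun j => G j ≠ P j))
    (fun j => min (G j) (P j)) ⟨k0, by simpa using h⟩
  refine ⟨k, by simpa using hk, hmin k0 (by simpa using h), fun j => ?_⟩
  by_cases hj : G j = P j
  · rw [hj]
  · have := hmin j (by simpa using hj)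
    rw [min_eq_left (this.trans (min_le_right _ _)), min_eq_left (this.trans (min_le_left _ _))]

lemma FF_strict {n : ℕ} (P : Fin n → ℝ) {x : ℝ} {k : Fin n} (h : x < P k) :
    FF P x < FF P (P k) := by
  apply Finset.sum_lt_sum
  · intro j _; exact min_le_min_right _ h.le
  · exact ⟨k, Finset.mem_univ _, by rw [min_eq_left h.le, min_self]; exact h⟩

lemma max_eq_greedy {n : ℕ} {b : Fin n → ℝ → ℝ} {c : Fin n → ℝ} {G X : Fin n → ℝ}
    (hbm : ∀ j, MonotoneOn (b j) (Set.Ici 0))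
    (hG : IsNE b c G) (hg : Greedy b c G univ) (hX : IsNE b c X)
    (hle : ∀ j, total G j ≤ total X j) : G = X := by
  by_contra hne
  obtain ⟨k0, hk0⟩ := Function.ne_iff.1 hne
  obtain ⟨k, hk, -, hag⟩ := first_diff k0 hk0
  rcases lt_or_gt_of_ne hk with h | h
  · rw [min_eq_left h.le] at hag
    obtain ⟨k', h1, h2, h3⟩ := greedy_key hg k h hag
    exact key_contra (hbm k') (hG.1 k) hX.1 hag h2 (hX.noDown k') h3
  · rw [min_eq_right h.le] at hag
    have h1 := hle k
    rw [total_eq_FF, total_eq_FF, FF_congr hag] at h1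
    exact absurd h1 (not_le.2 (FF_strict G h))

lemma growth {b : ℝ → ℝ} (hbm : MonotoneOn b (Set.Ici 0))
    (hv : Filter.Tendsto (fun t : ℝ => b (t + 1) - b t) Filter.atTop (nhds 0))
    {ε : ℝ} (hε : 0 < ε) : ∃ C, ∀ t, 0 ≤ t → b t ≤ C + ε * t := by
  have h1 : ∀ᶠ t in Filter.atTop, b (t + 1) - b t < ε := hv.eventually_lt_const hε
  obtain ⟨N0, hN0⟩ := Filter.eventually_atTop.1 h1
  set N := max N0 0 with hN
  have hNn : 0 ≤ N := le_max_right _ _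
  have h2 : ∀ m : ℕ, b (N + m) ≤ b N + ε * m := by
    intro m
    induction m with
    | zero => simp
    | succ m ih =>
      have := hN0 (N + m) (by have := le_max_left N0 0; have : (0:ℝ) ≤ m := m.cast_nonneg; linarith)
      push_cast
      rw [← add_assoc]
      linarith
  refine ⟨b N + ε, fun t ht => ?_⟩
  have h3 := Nat.lt_floor_add_one t
  have h4 := Nat.floor_le ht
  have h5 := h2 (⌊t⌋₊ + 1)
  push_cast at h5
  have h6 : b t ≤ b (N + (⌊t⌋₊ + 1)) :=
    hbm (Set.mem_Ici.2 ht) (Set.mem_Ici.2 (by positivity)) (by linarith)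
  have h7 : ε * ⌊t⌋₊ ≤ ε * t := by gcongr
  linarith

lemma last_argmax {b : ℝ → ℝ} {c : ℝ} (hc : 0 < c) (hbc : ContinuousOn b (Set.Ici 0))
    (hbm : MonotoneOn b (Set.Ici 0))
    (hv : Filter.Tendsto (fun t : ℝ => b (t + 1) - b t) Filter.atTop (nhds 0))
    {T m : ℝ} (hT : 0 ≤ T) (hm : 0 < m) :
    ∃ s, 0 ≤ s ∧ (∀ r, 0 ≤ r → b (T + m * r) - c * r ≤ b (T + m * s) - c * s) ∧
      ∀ r, s < r → b (T + m * r) - c * r < b (T + m * s) - c * s := by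
  obtain ⟨C, hC⟩ := growth hbm hv (ε := c / (2 * m)) (by positivity)
  set f : ℝ → ℝ := fun r => b (T + m * r) - c * r with hf
  have hfc : ContinuousOn f (Set.Ici 0) := by
    apply ContinuousOn.sub
    · apply hbc.comp (by fun_prop)
      intro r hr
      have : (0:ℝ) ≤ r := hr
      exact Set.mem_Ici.2 (by positivity)
    · fun_prop
  have hub : ∀ r, 0 ≤ r → f r ≤ C + c / (2 * m) * T - c / 2 * r := by
    intro r hr
    have := hC (T + m * r) (by positivity)
    have h2 : c / (2 * m) * (T + m * r) = c / (2 * m) * T + c / 2 * r := by field_simp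
    simp only [hf]
    linarith
  -- a bound beyond which f is below f 0
  obtain ⟨R, hR0, hR⟩ : ∃ R, 0 ≤ R ∧ ∀ r, R < r → f r < f 0 := by
    refine ⟨max 0 ((C + c / (2 * m) * T - f 0) / (c / 2)), le_max_left _ _, fun r hr => ?_⟩
    have h1 := (le_max_left _ _).trans hr.le
    have h2 := (le_max_right _ _).trans_lt hr
    rw [div_lt_iff₀ (by positivity)] at h2
    have := hub r h1
    linarith
  have hsub : Set.Icc 0 R ⊆ Set.Ici (0:ℝ) := fun x hx => hx.1
  obtain ⟨p, hp, hpmax⟩ := isCompact_Icc.exists_isMaxOn (Set.nonempty_Icc.2 hR0) (hfc.mono hsub)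
  have hpm : ∀ r, 0 ≤ r → f r ≤ f p := by
    intro r hr
    rcases le_or_gt r R with h | h
    · exact hpmax ⟨hr, h⟩
    · exact (hR r h).le.trans (hpmax ⟨le_rfl, hR0⟩)
  have hK : IsCompact (Set.Icc 0 R ∩ f ⁻¹' {f p}) := by
    apply isCompact_Icc.of_isClosed_subset _ Set.inter_subset_left
    exact (hfc.mono hsub).preimage_isClosed_of_isClosed isClosed_Icc isClosed_singleton
  obtain ⟨s, ⟨hs1, hs2⟩, hs3⟩ := hK.exists_isGreatest ⟨p, hp, rfl⟩
  have hs2' : f s = f p := hs2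
  refine ⟨s, hs1.1, fun r hr => (hpm r hr).trans hs2'.ge, fun r hr => ?_⟩
  have hr0 : 0 ≤ r := hs1.1.trans hr.le
  rcases le_or_gt r R with h | h
  · refine lt_of_le_of_ne ((hpm r hr0).trans hs2'.ge) fun he => ?_
    have := hs3 ⟨⟨hr0, h⟩, he.trans hs2'⟩
    linarith
  · exact ((hR r h).trans_le (hpm 0 le_rfl)).trans_le hs2'.ge

lemma concave_up {b : ℝ → ℝ} {c T m : ℝ} (hb : ConcaveOn ℝ (Set.Ici 0) b)
    (hT : 0 ≤ T) (hm : 0 < m) {r q s : ℝ} (hr : 0 ≤ r) (hrq : r ≤ q) (hqs : q ≤ s)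
    (hs : b (T + m * r) - c * r ≤ b (T + m * s) - c * s) :
    b (T + m * r) - c * r ≤ b (T + m * q) - c * q := by
  rcases hrq.eq_or_lt with rfl | hrq
  · exact le_rfl
  have hd : 0 < s - r := by linarith
  have h := hb.2 (show T + m * r ∈ Set.Ici (0:ℝ) from Set.mem_Ici.2 (by positivity))
    (show T + m * s ∈ Set.Ici (0:ℝ) from Set.mem_Ici.2 (by
      have : 0 ≤ s := by linarith
      positivity))
    (show 0 ≤ (s - q) / (s - r) from div_nonneg (by linarith) hd.le)
    (show 0 ≤ (q - r) / (s - r) from div_nonneg (by linarith) hd.le)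
    (by field_simp; ring)
  simp only [smul_eq_mul] at h
  have e : (s - q) / (s - r) * (T + m * r) + (q - r) / (s - r) * (T + m * s) = T + m * q := by
    field_simp; ring
  rw [e] at h
  set l := (q - r) / (s - r) with hl
  have hl0 : 0 ≤ l := div_nonneg (by linarith) hd.le
  have e2 : (s - q) / (s - r) = 1 - l := by rw [hl]; field_simp; ring
  have e3 : q = r + l * (s - r) := by rw [hl]; field_simp; ring
  rw [e2] at h
  have h5 := mul_nonneg hl0 (sub_nonneg.2 hs)
  have h6 : c * q = c * r + l * (c * s - c * r) := by
    rw [e3]; ring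
  rw [h6]
  linarith

lemma FF_active {n : ℕ} {G Y : Fin n → ℝ} {A : Finset (Fin n)} {x y x' : ℝ}
    (h1 : ∀ j, j ∉ A → G j = Y j) (h2 : ∀ j, j ∉ A → Y j ≤ x) (h3 : ∀ j ∈ A, x' ≤ G j)
    (hxy : x ≤ y) (hyx : y ≤ x') :
    FF G y = (∑ j ∈ univ.filter (fun j => j ∉ A), Y j) + (A.card : ℝ) * x
      + (A.card : ℝ) * (y - x) := by
  have : FF G y = (∑ j ∈ univ.filter (fun j => j ∉ A), Y j) + (A.card : ℝ) * y := by
    unfold FF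
    rw [← Finset.sum_filter_not_add_sum_filter univ (fun j => j ∈ A)]
    congr 1
    · apply Finset.sum_congr rfl
      intro j hj
      have hj : j ∉ A := by simpa using hj
      rw [h1 j hj, min_eq_right ((h2 j hj).trans hxy)]
    · rw [← nsmul_eq_mul, ← Finset.sum_const]
      apply Finset.sum_congr (by ext; simp)
      intro j hj
      exact min_eq_left (hyx.trans (h3 j (by simpa using hj)))
  rw [this]; ring

lemma exists_greedy {n : ℕ} {b : Fin n → ℝ → ℝ} {c : Fin n → ℝ}
    (hc : ∀ j, 0 < c j)
    (hbc : ∀ j, ContinuousOn (b j) (Set.Ici 0))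
    (hbm : ∀ j, MonotoneOn (b j) (Set.Ici 0))
    (hbconc : ∀ j, ConcaveOn ℝ (Set.Ici 0) (b j))
    (hvanish : ∀ j, Filter.Tendsto (fun t : ℝ => b j (t + 1) - b j t)
      Filter.atTop (nhds 0)) (N : ℕ) :
    ∀ (A : Finset (Fin n)), A.card = N → ∀ (Y : Fin n → ℝ) (x : ℝ), 0 ≤ x →
      (∀ j, j ∉ A → 0 ≤ Y j) → (∀ j, j ∉ A → Y j ≤ x) →
      ∃ G : Fin n → ℝ, (∀ j, j ∉ A → G j = Y j) ∧ (∀ j ∈ A, x ≤ G j) ∧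
        Greedy b c G A ∧ ∀ k ∈ A, NoDown (b k) (c k) G k x := by
  induction N with
  | zero =>
    intro A hA Y x hx hY0 hY
    rw [Finset.card_eq_zero] at hA
    subst hA
    refine ⟨Y, fun _ _ => rfl, by simp, ?_, by simp⟩
    intro S hS hne
    exact absurd (Finset.subset_empty.1 hS) hne.ne_empty
  | succ N ih =>
    intro A hA Y x hx hY0 hY
    have hm : (0:ℝ) < A.card := by rw [hA]; positivity
    have hAne : A.Nonempty := by rw [← Finset.card_pos]; omega
    set T := (∑ j ∈ univ.filter (fun j => j ∉ A), Y j) + (A.card : ℝ) * x with hTdef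
    have hT : 0 ≤ T := by
      apply add_nonneg
      · exact Finset.sum_nonneg fun j hj => hY0 j (by simpa using hj)
      · positivity
    choose s hs0 hs1 hs2 using fun k => last_argmax (hc k) (hbc k) (hbm k) (hvanish k) hT hm
    obtain ⟨k0, hk0, hmin⟩ := Finset.exists_min_image A s hAne
    have hxx : x ≤ x + s k0 := by linarith [hs0 k0]
    obtain ⟨G, hG1, hG2, hG3, hG4⟩ := ih (A.erase k0)
      (by rw [Finset.card_erase_of_mem hk0]; omega) (Function.update Y k0 (x + s k0)) (x + s k0)
      (hx.trans hxx)
      (by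
        intro j hj
        by_cases hjk : j = k0
        · subst hjk; rw [Function.update_self]; linarith
        · rw [Function.update_of_ne hjk]
          exact hY0 j (fun h => hj (Finset.mem_erase.2 ⟨hjk, h⟩)))
      (by
        intro j hj
        by_cases hjk : j = k0
        · subst hjk; rw [Function.update_self]
        · rw [Function.update_of_ne hjk]
          exact (hY j (fun h => hj (Finset.mem_erase.2 ⟨hjk, h⟩))).trans hxx)
    have hGk0 : G k0 = x + s k0 := by rw [hG1 k0 (by simp), Function.update_self]
    have hGA : ∀ j ∈ A, x + s k0 ≤ G j := by
      intro j hj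
      by_cases hjk : j = k0
      · rw [hjk, hGk0]
      · exact hG2 j (Finset.mem_erase.2 ⟨hjk, hj⟩)
    have hGY : ∀ j, j ∉ A → G j = Y j := by
      intro j hj
      have hjk : j ≠ k0 := fun h => hj (h ▸ hk0)
      rw [hG1 j (fun h => hj (Finset.mem_of_mem_erase h)), Function.update_of_ne hjk]
    have hF : ∀ y, x ≤ y → y ≤ x + s k0 → FF G y = T + (A.card : ℝ) * (y - x) :=
      fun y h1 h2 => FF_active hGY hY hGA h1 h2
    have hup : ∀ k ∈ A, ∀ y, x ≤ y → y ≤ x + s k0 →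
        b k (FF G y) - c k * y ≤ b k (FF G (x + s k0)) - c k * (x + s k0) := by
      intro k hk y h1 h2
      rw [hF y h1 h2, hF _ hxx le_rfl]
      have := concave_up (c := c k) (hbconc k) hT hm (r := y - x) (q := s k0) (s := s k)
        (by linarith) (by linarith) (hmin k hk) (hs1 k (y - x) (by linarith))
      have e : x + s k0 - x = s k0 := by ring
      rw [e]
      linarith
    refine ⟨G, hGY, fun j hj => hxx.trans (hGA j hj), ?_, ?_⟩
    · intro S hS hne
      by_cases hk : k0 ∈ S
      · refine ⟨k0, hk, fun j hj => hGk0 ▸ hGA j (hS hj), fun r hr => ?_⟩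
        rw [hGk0, hF _ hxx le_rfl]
        have e : x + s k0 - x = s k0 := by ring
        rw [e]
        have h1 := hs2 k0 (s k0 + r) (by linarith)
        have h2 : (S.card : ℝ) ≤ A.card := by exact_mod_cast Finset.card_le_card hS
        have h3 : (S.card : ℝ) * r ≤ A.card * r := by gcongr
        have h0 := hs0 k0
        have h4 := hbm k0
          (a := T + A.card * s k0 + S.card * r) (Set.mem_Ici.2 (by positivity))
          (b := T + A.card * (s k0 + r)) (Set.mem_Ici.2 (by positivity)) (by linarith)
        linarith
      · exact hG3 S (fun j hj => Finset.mem_erase.2 ⟨fun h => hk (h ▸ hj), hS hj⟩) hne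
    · intro k hk y hy hyk
      by_cases hkk : k = k0
      · subst hkk
        rw [hGk0] at hyk ⊢
        exact hup k hk y hy hyk
      · have hk' : k ∈ A.erase k0 := Finset.mem_erase.2 ⟨hkk, hk⟩
        rcases le_or_gt y (x + s k0) with h | h
        · exact (hup k hk y hy h).trans (hG4 k hk' _ le_rfl (hG2 k hk'))
        · exact hG4 k hk' y h.le hyk

lemma greedy_of_max {n : ℕ} {b : Fin n → ℝ → ℝ} {c : Fin n → ℝ}
    (hc : ∀ j, 0 < c j)
    (hbc : ∀ j, ContinuousOn (b j) (Set.Ici 0))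
    (hbm : ∀ j, MonotoneOn (b j) (Set.Ici 0))
    (hbconc : ∀ j, ConcaveOn ℝ (Set.Ici 0) (b j))
    (hvanish : ∀ j, Filter.Tendsto (fun t : ℝ => b j (t + 1) - b j t)
      Filter.atTop (nhds 0))
    {X : Fin n → ℝ} (hX : IsNE b c X)
    (hXmax : ∀ X'' : Fin n → ℝ, IsNE b c X'' → ∀ j, total X'' j ≤ total X j) :
    Greedy b c X univ := by
  obtain ⟨G, -, h2, h3, h4⟩ := exists_greedy hc hbc hbm hbconc hvanish _ univ rfl (fun _ => 0) 0
    le_rfl (by simp) (by simp)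
  have hG : IsNE b c G :=
    isNE_of_greedy hbm (fun j => h2 j (mem_univ j)) h3 (fun k => h4 k (mem_univ k))
  have := max_eq_greedy hbm hG h3 hX (hXmax G hG)
  exact this ▸ h3

/-- Truthfulness under partial enforcement (Model 2): measuring agent `i`'s payoff using
the outside-option value `vᵢ`, a misreport that changes the maximal equilibrium from `X`
to `X'` cannot improve agent `i`'s payoff. -/
theorem truthful_partial_enforcement (n : ℕ) (hn : 1 ≤ n)
    (b : Fin n → ℝ → ℝ) (c : Fin n → ℝ)
    (hc : ∀ j, 0 < c j)
    (hbc : ∀ j, ContinuousOn (b j) (Set.Ici 0))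
    (hbm : ∀ j, MonotoneOn (b j) (Set.Ici 0))
    (hbconc : ∀ j, ConcaveOn ℝ (Set.Ici 0) (b j))
    (hvanish : ∀ j, Filter.Tendsto (fun t : ℝ => b j (t + 1) - b j t)
      Filter.atTop (nhds 0))
    (i : Fin n) (bhat : ℝ → ℝ) (chat : ℝ)
    (hchat : 0 < chat)
    (hbhatc : ContinuousOn bhat (Set.Ici 0))
    (hbhatm : MonotoneOn bhat (Set.Ici 0))
    (hbhatconc : ConcaveOn ℝ (Set.Ici 0) bhat)
    (hbhatvanish : Filter.Tendsto (fun t : ℝ => bhat (t + 1) - bhat t)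
      Filter.atTop (nhds 0))
    (X : Fin n → ℝ) (hX : IsNE b c X)
    (hXmax : ∀ X'' : Fin n → ℝ, IsNE b c X'' → ∀ j, total X'' j ≤ total X j)
    (X' : Fin n → ℝ)
    (hX' : IsNE (Function.update b i bhat) (Function.update c i chat) X')
    (hX'max : ∀ X'' : Fin n → ℝ,
      IsNE (Function.update b i bhat) (Function.update c i chat) X'' →
      ∀ j, total X'' j ≤ total X' j) :
    outsideOption (b i) (c i) (total X' i) - c i * X' i ≤
      outsideOption (b i) (c i) (total X i) - c i * X i := by
  have hg := greedy_of_max hc hbc hbm hbconc hvanish hX hXmax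
  have upd : ∀ (p : (ℝ → ℝ) → Prop), (∀ j, p (b j)) → p bhat →
      ∀ j, p (Function.update b i bhat j) := by
    intro p h1 h2 j
    by_cases hj : j = i
    · subst hj; rwa [Function.update_self]
    · rw [Function.update_of_ne hj]; exact h1 j
  have hbm' := upd (fun f => MonotoneOn f (Set.Ici 0)) hbm hbhatm
  have hg' := greedy_of_max
    (by
      intro j
      by_cases hj : j = i
      · subst hj; rwa [Function.update_self]
      · rw [Function.update_of_ne hj]; exact hc j)
    (upd (fun f => ContinuousOn f (Set.Ici 0)) hbc hbhatc)
    hbm'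
    (upd (fun f => ConcaveOn ℝ (Set.Ici 0) f) hbconc hbhatconc)
    (upd (fun f => Filter.Tendsto (fun t : ℝ => f (t + 1) - f t) Filter.atTop (nhds 0))
      hvanish hbhatvanish) hX' hX'max
  have hd' : ∀ k, k ≠ i → NoDown (b k) (c k) X' k 0 := by
    intro k hk
    have := hX'.noDown k
    rwa [Function.update_of_ne hk, Function.update_of_ne hk] at this
  -- agreement below the smaller of the two levels of agent i
  have hag : ∀ j, min (min (X i) (X' i)) (X' j) = min (min (X i) (X' i)) (X j) := by
    by_contra hcon
    push Not at hcon
    obtain ⟨k0, hk0⟩ := hcon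
    have hne : X k0 ≠ X' k0 := fun h => hk0 (by rw [h])
    have hlt : min (X k0) (X' k0) < min (X i) (X' i) := by
      by_contra h
      push Not at h
      exact hk0 (by rw [min_eq_left (h.trans (min_le_right _ _)),
        min_eq_left (h.trans (min_le_left _ _))])
    obtain ⟨k, hk, hkle, hkag⟩ := first_diff k0 hne
    have hlt2 := hkle.trans_lt hlt
    rcases lt_or_gt_of_ne hk with h | h
    · rw [min_eq_left h.le] at hkag hlt2
      obtain ⟨k', h1, h2, h3⟩ := greedy_key hg k h hkag
      have hk'i : k' ≠ i := by
        rintro rfl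
        have := hlt2.trans_le (min_le_left _ _)
        linarith
      exact key_contra (hbm k') (hX.1 k) hX'.1 hkag h2 (hd' k' hk'i) h3
    · rw [min_eq_right h.le] at hkag hlt2
      have hkag2 : ∀ j, min (X' k) (X j) = min (X' k) (X' j) := fun j => (hkag j).symm
      obtain ⟨k', h1, h2, h3⟩ := greedy_key hg' k h hkag2
      have hk'i : k' ≠ i := by
        rintro rfl
        have := hlt2.trans_le (min_le_right _ _)
        linarith
      rw [Function.update_of_ne hk'i, Function.update_of_ne hk'i] at h3
      exact key_contra (hbm k') (hX'.1 k) hX.1 hkag2 h2 (hX.noDown k') h3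
  -- upward deviations
  have hdev : ∀ y, 0 ≤ y → b i (FF X y - min y (X i) + y) - c i * y
      ≤ b i (FF X (X i)) - c i * X i := by
    intro y hy
    have := hX.2 i y hy
    unfold U at this
    rwa [total_upd, total_eq_FF, Function.update_self] at this
  have hlift : ∀ y z, 0 ≤ y → y ≤ X i → 0 ≤ z →
      b i (FF X y + z) - c i * (y + z) ≤ b i (FF X (X i)) - c i * X i := by
    intro y z hy hyi hz
    refine le_trans ?_ (hdev (y + z) (by linarith))
    have h0 := FF_nonneg hX.1 hy
    have h1 : FF X y + z ≤ FF X (y + z) - min (y + z) (X i) + (y + z) := by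
      have e1 := total_upd X i y
      have e2 := total_upd X i (y + z)
      have hle : FF X y - min y (X i) ≤ FF X (y + z) - min (y + z) (X i) := by
        unfold FF
        rw [← Finset.add_sum_erase univ _ (Finset.mem_univ i),
          ← Finset.add_sum_erase univ (fun j => min (y + z) (X j)) (Finset.mem_univ i)]
        have : ∑ j ∈ univ.erase i, min y (X j) ≤ ∑ j ∈ univ.erase i, min (y + z) (X j) :=
          Finset.sum_le_sum fun j _ => min_le_min_right _ (by linarith)
        linarith
      rw [min_eq_left hyi] at hle
      linarith
    have := hbm i (Set.mem_Ici.2 (by linarith)) (Set.mem_Ici.2 (by linarith)) h1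
    linarith
  have hmain : ∀ z, 0 ≤ z → b i (total X' i + z) - c i * z - c i * X' i
      ≤ b i (total X i) - c i * X i := by
    intro z hz
    rw [total_eq_FF, total_eq_FF]
    rcases le_or_gt (X' i) (X i) with h | h
    · rw [min_eq_right h] at hag
      rw [FF_congr hag]
      have := hlift (X' i) z (hX'.1 i) h hz
      linarith
    · rw [min_eq_left h.le] at hag
      obtain ⟨k', h1, h2, h3⟩ := greedy_key hg i h hag
      by_cases hk : k' = i
      · subst hk
        have h4 := h3 (X' k' + z - X k') (by linarith)
        have h5 := FF_slope X' h.le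
        rw [FF_congr hag] at h5
        set S := univ.filter (fun j => X k' < X' j) with hS
        have h6 : (1:ℝ) ≤ S.card := by
          exact_mod_cast Finset.card_pos.2 ⟨k', by simpa [hS] using h⟩
        have h7 : FF X' (X' k') + z ≤ FF X (X k') + S.card * (X' k' + z - X k') := by
          nlinarith
        have h0 := FF_nonneg hX'.1 (hX'.1 k')
        have := hbm k' (Set.mem_Ici.2 (by linarith)) (Set.mem_Ici.2 (by linarith)) h7
        linarith
      · exact (key_contra (hbm k') (hX.1 i) hX'.1 hag h2 (hd' k' hk) h3).elim
  have hbdd : BddAbove ((fun z => b i (total X i + z) - c i * z) '' Set.Ici 0) := by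
    refine ⟨b i (FF X (X i)), ?_⟩
    rintro _ ⟨z, hz, rfl⟩
    have := hlift (X i) z (hX.1 i) le_rfl hz
    simp only [total_eq_FF]
    linarith
  have hR : b i (total X i) ≤ outsideOption (b i) (c i) (total X i) :=
    le_csSup hbdd ⟨0, Set.mem_Ici.2 le_rfl, by simp⟩
  have hL : outsideOption (b i) (c i) (total X' i) ≤
      b i (total X i) - c i * X i + c i * X' i := by
    apply csSup_le (Set.Nonempty.image _ ⟨0, Set.mem_Ici.2 le_rfl⟩)
    rintro _ ⟨z, hz, rfl⟩
    have := hmain z hz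
    simp only
    linarith
  linarith
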